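/- For every d∈ℕ+ there exist a universal constant c>0 (independent of d) and 8-layer EUAF-transformer parameters Θ# with token dimension 4d+8, at most 8 attention heads in each attention layer, FFN width at most c·d, at most c·d nonzero parameter entries in total, all parameter entries of absolute value at most c, such that Θ# has the EUAF emulation property. -/

import Mathlib

open scoped BigOperators
open Matrix

noncomputable section

namespace PromptTF

/-- The ReLU activation function. -/
def relu (x : ℝ) : ℝ := max x 0

/-- The elementary universal activation function (EUAF). -/
def euaf (x : ℝ) : ℝ :=
  if 0 ≤ x then |x - 2 * (⌊(x + 1) / 2⌋ : ℝ)| else x / (1 + |x|)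

/-- Parameters of one transformer layer (attention heads and a feed-forward net). -/
structure TFLayer (D : ℕ) where
  M : ℕ
  Q : Fin M → Matrix (Fin D) (Fin D) ℝ
  K : Fin M → Matrix (Fin D) (Fin D) ℝ
  V : Fin M → Matrix (Fin D) (Fin D) ℝ
  width : ℕ
  W1 : Matrix (Fin width) (Fin D) ℝ
  W2 : Matrix (Fin D) (Fin width) ℝ

/-- Self-attention layer applied to a list of tokens. -/
def attnOut {D : ℕ} (θ : TFLayer D) (H : List (Fin D → ℝ)) : List (Fin D → ℝ) :=
  H.map fun h => fun i =>
    h i + ∑ m : Fin θ.M,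
      (H.map fun h' =>
        relu (dotProduct ((θ.Q m).mulVec h) ((θ.K m).mulVec h')) * ((θ.V m).mulVec h') i).sum

/-- One transformer layer `FFN ∘ Attn`, with feed-forward activation `act`. -/
def layerMap {D : ℕ} (act : ℝ → ℝ) (θ : TFLayer D) (H : List (Fin D → ℝ)) :
    List (Fin D → ℝ) :=
  (attnOut θ H).map fun h => fun i =>
    h i + (θ.W2.mulVec fun k => act ((θ.W1.mulVec h) k)) i

/-- Multi-layer transformer, all activations ReLU. -/
def tfForward {D : ℕ} (Θ : List (TFLayer D)) (H : List (Fin D → ℝ)) : List (Fin D → ℝ) :=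
  Θ.foldl (fun H' θ => layerMap relu θ H') H

/-- Multi-layer transformer whose first feed-forward layer uses the EUAF activation. -/
def tfForwardEUAF {D : ℕ} (Θ : List (TFLayer D)) (H : List (Fin D → ℝ)) :
    List (Fin D → ℝ) :=
  match Θ with
  | [] => H
  | θ :: rest => rest.foldl (fun H' θ' => layerMap relu θ' H') (layerMap euaf θ H)

/-- Sequential (autoregressive) generation: append the last output column repeatedly. -/
def genTokens {D : ℕ} (forward : List (Fin D → ℝ) → List (Fin D → ℝ))
    (H : List (Fin D → ℝ)) : ℕ → List (Fin D → ℝ)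
  | 0 => H
  | v + 1 =>
      genTokens forward H v ++ [(forward (genTokens forward H v)).getLastD (fun _ => 0)]

/-- The token at one-based position `m` in the generated sequence. -/
def tokenAt {D : ℕ} (forward : List (Fin D → ℝ) → List (Fin D → ℝ))
    (H : List (Fin D → ℝ)) (m : ℕ) : Fin D → ℝ :=
  (genTokens forward H (m - H.length)).getD (m - 1) (fun _ => 0)

/-- A token with word embedding `u`, layer index `w`, position `j` and scale `S`:
`(uᵀ, 0_{3d+4}ᵀ, 1, S, S·w, S·j)ᵀ ∈ ℝ^{4d+8}`. -/
def promptToken (d : ℕ) (u : Fin d → ℝ) (w : ℤ) (j : ℕ) (S : ℝ) : Fin (4 * d + 8) → ℝ :=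
  fun i =>
    if h : (i : ℕ) < d then u ⟨i, h⟩
    else if (i : ℕ) = 4 * d + 4 then 1
    else if (i : ℕ) = 4 * d + 5 then S
    else if (i : ℕ) = 4 * d + 6 then S * w
    else if (i : ℕ) = 4 * d + 7 then S * j
    else 0

/-- First `d` coordinates of a token. -/
def firstd (d : ℕ) (h : Fin (4 * d + 8) → ℝ) : Fin d → ℝ :=
  fun k => h (Fin.castLE (by omega) k)

/-- Initial input: `T` prompt tokens followed by `N` data tokens. -/
def initialInput (d T N : ℕ) (u : Fin T → Fin d → ℝ) (w : Fin T → ℕ) (S : ℝ)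
    (z : Fin N → Fin d → ℝ) : List (Fin (4 * d + 8) → ℝ) :=
  ((List.finRange T).map fun j => promptToken d (u j) (w j) ((j : ℕ) + 1) S)
    ++ ((List.finRange N).map fun i => promptToken d (z i) 0 (T + (i : ℕ) + 1) S)

/-- The closed Euclidean ball of radius `B` in `ℝ^d`. -/
def eball (d : ℕ) (B : ℝ) : Set (Fin d → ℝ) :=
  {v | Real.sqrt (∑ k, v k ^ 2) ≤ B}

/-- Data of a valid prompt in `P_U(T, L, S)`: word embeddings in `U`,
layer indices in `{1, …, 2L}`. -/
def ValidPrompt {d : ℕ} (U : Set (Fin d → ℝ)) (T L : ℕ)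
    (u : Fin T → Fin d → ℝ) (w : Fin T → ℕ) : Prop :=
  (∀ j, u j ∈ U) ∧ ∀ j, 1 ≤ w j ∧ w j ≤ 2 * L

/-- The virtual weight matrix `W^P_ℓ` (without the first-layer correction term). -/
def WPmat {d T : ℕ} (u : Fin T → Fin d → ℝ) (w : Fin T → ℕ) (ℓ : ℕ) :
    Matrix (Fin d) (Fin d) ℝ :=
  ∑ j : Fin T,
    if h : (j : ℕ) + 1 < T then
      (if w j = 2 * ℓ - 1 ∧ w ⟨(j : ℕ) + 1, h⟩ = 2 * ℓ then
        vecMulVec (u j) (u ⟨(j : ℕ) + 1, h⟩) else 0)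
    else 0

/-- The first-layer correction term `(h_T)_{1:d} 1{w_T=1} Σ_{j'} (h_{j'})_{1:d}ᵀ 1{w_{j'}=1}`. -/
def WPcorr {d T : ℕ} (u : Fin T → Fin d → ℝ) (w : Fin T → ℕ) :
    Matrix (Fin d) (Fin d) ℝ :=
  if hT : 0 < T then
    (if w ⟨T - 1, by omega⟩ = 1 then
      vecMulVec (u ⟨T - 1, by omega⟩) (∑ j : Fin T, if w j = 1 then u j else 0)
    else 0)
  else 0

/-- The virtual first-layer weight matrix `W^P_{1,i}`; `first` indicates `i = 1`. -/
def WPone {d T : ℕ} (u : Fin T → Fin d → ℝ) (w : Fin T → ℕ) (first : Bool) :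
    Matrix (Fin d) (Fin d) ℝ :=
  WPmat u w 1 + if first then WPcorr u w else 0

/-- The family of virtual weight matrices of a prompt, for the data token with
zero-based index `i`. -/
def WPfam {d T : ℕ} (u : Fin T → Fin d → ℝ) (w : Fin T → ℕ) (i : ℕ) :
    ℕ → Matrix (Fin d) (Fin d) ℝ :=
  fun ℓ => if ℓ = 1 then WPone u w (i == 0) else WPmat u w ℓ

/-- Output of the virtual network after `ℓ` layers:
`vnetOut … ℓ = W_ℓ act(W_{ℓ-1} act( ⋯ act(W_1 z) ⋯ ))`. -/
def vnetOut (d : ℕ) (act : ℝ → ℝ) (Ws : ℕ → Matrix (Fin d) (Fin d) ℝ)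
    (z : Fin d → ℝ) : ℕ → Fin d → ℝ
  | 0 => z
  | ℓ + 1 =>
      (Ws (ℓ + 1)).mulVec fun k =>
        if ℓ = 0 then vnetOut d act Ws z ℓ k else act (vnetOut d act Ws z ℓ k)

/-- The emulation property: for every admissible prompt and data tokens, the sequentially
generated tokens realize the virtual neural network encoded by the prompt
(with activation `act`). -/
def EmulatesWith (d : ℕ)
    (forward : List (Fin (4 * d + 8) → ℝ) → List (Fin (4 * d + 8) → ℝ))
    (act : ℝ → ℝ) : Prop :=
  ∀ B : ℝ, 1 ≤ B → ∀ T L : ℕ, 0 < T → 0 < L →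
  ∀ U : Set (Fin d → ℝ), U ⊆ eball d B →
  ∀ S : ℝ, max ((d : ℝ) * B ^ (4 * L) * (T : ℝ) ^ (2 * L)) (2 * (L : ℝ)) ≤ S →
  ∀ (u : Fin T → Fin d → ℝ) (w : Fin T → ℕ), ValidPrompt U T L u w →
  ∀ N : ℕ, 0 < N → ∀ z : Fin N → Fin d → ℝ, (∀ i k, z i k ∈ Set.Icc (0 : ℝ) 1) →
  ∀ (i : Fin N) (ℓ : ℕ), 1 ≤ ℓ → ℓ ≤ L →
    tokenAt forward (initialInput d T N u w S z) (T + N * ℓ + (i : ℕ) + 1)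
      = promptToken d (vnetOut d act (WPfam u w (i : ℕ)) (z i) ℓ) (-(ℓ : ℤ))
          (T + N * ℓ + (i : ℕ) + 1) S

/-- The embedding `x ↦ (xᵀ, 1, 0_{d-p-1}ᵀ)ᵀ ∈ ℝ^d` of an input `x ∈ ℝ^p`. -/
def embed (d p : ℕ) (x : Fin p → ℝ) : Fin d → ℝ :=
  fun k => if h : (k : ℕ) < p then x ⟨k, h⟩ else if (k : ℕ) = p then 1 else 0

/-- The function approximator `f̂_{Θ,H^P,L,p}`: first coordinate of the token at
position `T+1+L` generated from the prompt followed by the single data token. -/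
def fhat {d : ℕ} (forward : List (Fin (4 * d + 8) → ℝ) → List (Fin (4 * d + 8) → ℝ))
    {T : ℕ} (u : Fin T → Fin d → ℝ) (w : Fin T → ℕ) (S : ℝ) (L p : ℕ)
    (x : Fin p → ℝ) : ℝ :=
  tokenAt forward (initialInput d T 1 u w S fun _ => embed d p x) (T + 1 + L)
    ⟨0, by omega⟩

/-- The unit cube `[0,1]^p`. -/
def unitCube (p : ℕ) : Set (Fin p → ℝ) := Set.Icc 0 1

/-- The sup-distance `‖f - g‖_{L^∞([0,1]^p)}`. -/
def supDist (p : ℕ) (f g : (Fin p → ℝ) → ℝ) : ℝ :=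
  ⨆ x : unitCube p, |f x.1 - g x.1|

/-- Partial derivative (within the unit cube) in coordinate direction `i`. -/
def pderivW (p : ℕ) (i : Fin p) (f : (Fin p → ℝ) → ℝ) : (Fin p → ℝ) → ℝ :=
  fun x => fderivWithin ℝ f (unitCube p) x (Pi.single i 1)

/-- Iterated partial derivative along a list of coordinate directions. -/
def pderivList (p : ℕ) : List (Fin p) → ((Fin p → ℝ) → ℝ) → (Fin p → ℝ) → ℝ
  | [], f => f
  | i :: is, f => pderivList p is (pderivW p i f)

/-- The unit ball `C_u^β([0,1]^p)` of `β`-times continuously differentiable functions with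
all partial derivatives of order `≤ β` bounded by `1` on the cube. -/
def Hclass (p β : ℕ) : Set ((Fin p → ℝ) → ℝ) :=
  {f | ContDiffOn ℝ β f (unitCube p) ∧
    ∀ ls : List (Fin p), ls.length ≤ β →
      ∀ x ∈ unitCube p, |pderivList p ls f x| ≤ 1}

/-- `U_{d,r}` : the span of the first `r` standard basis vectors of `ℝ^d`. -/
def spanFirst (d r : ℕ) : Set (Fin d → ℝ) :=
  {v | ∀ k : Fin d, r ≤ (k : ℕ) → v k = 0}

/-- Hidden layers of a standard ReLU network of width `r` (with biases). -/
def nnHidden {p r : ℕ} (W0 : Matrix (Fin r) (Fin p) ℝ) (b0 : Fin r → ℝ)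
    (Wm : ℕ → Matrix (Fin r) (Fin r) ℝ) (bm : ℕ → Fin r → ℝ) (x : Fin p → ℝ) :
    ℕ → Fin r → ℝ
  | 0 => fun i => W0.mulVec x i + b0 i
  | k + 1 => fun i =>
      (Wm k).mulVec (fun j => relu (nnHidden W0 b0 Wm bm x k j)) i + bm k i

/-- The class `N(r,p,L)` of ReLU networks `ℝ^p → ℝ` of width `r` and depth `L`
(`L` affine maps with ReLU in between). -/
def NNclass (r p L : ℕ) : Set ((Fin p → ℝ) → ℝ) :=
  {f | if L = 1 then ∃ (a : Fin p → ℝ) (b : ℝ), f = fun x => (∑ i, a i * x i) + b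
    else ∃ (W0 : Matrix (Fin r) (Fin p) ℝ) (b0 : Fin r → ℝ)
      (Wm : ℕ → Matrix (Fin r) (Fin r) ℝ) (bm : ℕ → Fin r → ℝ)
      (wL : Fin r → ℝ) (bL : ℝ),
      f = fun x => (∑ j, wL j * relu (nnHidden W0 b0 Wm bm x (L - 2) j)) + bL}

/-- Operator norm (w.r.t. the Euclidean norm) of a `d × d` matrix. -/
def opNorm {d : ℕ} (W : Matrix (Fin d) (Fin d) ℝ) : ℝ :=
  ‖LinearMap.toContinuousLinearMap (Matrix.toEuclideanLin W)‖

/-- The class `W(r,d,U,B)` of coarse weight matrices. -/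
def coarseW (d r : ℕ) (U : Set (Fin d → ℝ)) (B : ℝ) :
    Set (Matrix (Fin d) (Fin d) ℝ) :=
  {W | (∃ ut uu : Fin r → Fin d → ℝ,
        (∀ k, ut k ∈ U) ∧ (∀ k, uu k ∈ U) ∧ W = ∑ k, vecMulVec (ut k) (uu k)) ∧
    opNorm W ≤ B ^ 2}

open Classical in
/-- Number of nonzero parameter entries of one transformer layer. -/
def layerNonzero {D : ℕ} (θ : TFLayer D) : ℕ :=
  (Finset.univ.filter fun p : Fin θ.M × Fin D × Fin D => θ.Q p.1 p.2.1 p.2.2 ≠ 0).card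
  + (Finset.univ.filter fun p : Fin θ.M × Fin D × Fin D => θ.K p.1 p.2.1 p.2.2 ≠ 0).card
  + (Finset.univ.filter fun p : Fin θ.M × Fin D × Fin D => θ.V p.1 p.2.1 p.2.2 ≠ 0).card
  + (Finset.univ.filter fun p : Fin θ.width × Fin D => θ.W1 p.1 p.2 ≠ 0).card
  + (Finset.univ.filter fun p : Fin D × Fin θ.width => θ.W2 p.1 p.2 ≠ 0).card

/-- Total number of nonzero parameter entries of a transformer. -/
def tfNonzero {D : ℕ} (Θ : List (TFLayer D)) : ℕ := (Θ.map layerNonzero).sum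

/-- All parameter entries of one layer bounded in absolute value by `c`. -/
def layerEntriesBounded {D : ℕ} (θ : TFLayer D) (c : ℝ) : Prop :=
  (∀ m i j, |θ.Q m i j| ≤ c) ∧ (∀ m i j, |θ.K m i j| ≤ c) ∧ (∀ m i j, |θ.V m i j| ≤ c)
  ∧ (∀ i j, |θ.W1 i j| ≤ c) ∧ ∀ i j, |θ.W2 i j| ≤ c

end PromptTF
end

noncomputable section

namespace PromptTF

/-! ### Coordinates, tokens and elementary matrices -/

/-- The `k`-th coordinate of the `a`-th block of length `d`. -/
def bi {d : ℕ} (a : Fin 4) (k : Fin d) : Fin (4 * d + 8) :=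
  Fin.castAdd 8 (finProdFinEquiv (a, k))

/-- The `s`-th scalar coordinate, behind the four blocks. -/
def si {d : ℕ} (s : Fin 8) : Fin (4 * d + 8) := Fin.natAdd (4 * d) s

lemma bi_inj {d : ℕ} {a b : Fin 4} {k l : Fin d} : bi a k = bi b l ↔ a = b ∧ k = l := by
  simp [bi]

lemma si_inj {d : ℕ} {s t : Fin 8} : (si s : Fin (4 * d + 8)) = si t ↔ s = t := by
  simp [si]

lemma bi_ne_si {d : ℕ} (a : Fin 4) (k : Fin d) (s : Fin 8) : bi a k ≠ si s := by
  intro h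
  have := congrArg Fin.val h
  simp only [bi, si, Fin.val_castAdd, Fin.val_natAdd] at this
  omega

lemma coord_cases {d : ℕ} (i : Fin (4 * d + 8)) :
    (∃ (a : Fin 4) (k : Fin d), i = bi a k) ∨ ∃ s : Fin 8, i = si s := by
  refine Fin.addCases (fun p => Or.inl ?_) (fun s => Or.inr ⟨s, rfl⟩) i
  exact ⟨(finProdFinEquiv.symm p).1, (finProdFinEquiv.symm p).2, by
    rw [bi, Prod.mk.eta, Equiv.apply_symm_apply]⟩

/-- The token with given blocks and scalar coordinates. -/
def tok {d : ℕ} (b : Fin 4 → Fin d → ℝ) (s : Fin 8 → ℝ) : Fin (4 * d + 8) → ℝ :=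
  Fin.addCases (fun p => b (finProdFinEquiv.symm p).1 (finProdFinEquiv.symm p).2) s

@[simp] lemma tok_bi {d : ℕ} (b : Fin 4 → Fin d → ℝ) (s : Fin 8 → ℝ) (a : Fin 4) (k : Fin d) :
    tok b s (bi a k) = b a k := by
  simp only [tok, bi, Fin.addCases_left, Equiv.symm_apply_apply]

@[simp] lemma tok_si {d : ℕ} (b : Fin 4 → Fin d → ℝ) (s : Fin 8 → ℝ) (t : Fin 8) :
    tok b s (si t) = s t := by
  simp only [tok, si, Fin.addCases_right]

lemma token_ext {d : ℕ} {h h' : Fin (4 * d + 8) → ℝ}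
    (hb : ∀ a k, h (bi a k) = h' (bi a k)) (hs : ∀ s, h (si s) = h' (si s)) : h = h' := by
  funext i
  rcases coord_cases i with ⟨a, k, rfl⟩ | ⟨s, rfl⟩
  · exact hb a k
  · exact hs s

lemma promptToken_eq_tok (d : ℕ) (u : Fin d → ℝ) (w : ℤ) (j : ℕ) (S : ℝ) :
    promptToken d u w j S = tok ![u, 0, 0, 0] ![0, 0, 0, 0, 1, S, S * w, S * j] := by
  refine token_ext (fun a k => ?_) (fun s => ?_)
  · have hk := k.2
    rw [tok_bi]
    have hv : ((bi a k : Fin (4 * d + 8)) : ℕ) = k + d * a := by simp [bi]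
    have hlt : k + d * (a : ℕ) < 4 * d := by
      have := (finProdFinEquiv (a, k)).2
      simpa using this
    unfold promptToken
    fin_cases a
    · have h0 : ((bi 0 k : Fin (4 * d + 8)) : ℕ) = k := by simp [bi]
      simp [h0]
    all_goals
      rw [dif_neg (by rw [hv]; simp; try omega), if_neg (by rw [hv]; simp at hlt ⊢; omega),
        if_neg (by rw [hv]; simp at hlt ⊢; omega), if_neg (by rw [hv]; simp at hlt ⊢; omega),
        if_neg (by rw [hv]; simp at hlt ⊢; omega)]
      simp
  · rw [tok_si]
    have hv : ((si s : Fin (4 * d + 8)) : ℕ) = 4 * d + s := by simp [si]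
    unfold promptToken
    rw [dif_neg (by rw [hv]; omega)]
    simp only [hv]
    fin_cases s <;> simp

/-- The matrix copying block `b` into block `a`. -/
def blk {d : ℕ} (a b : Fin 4) : Matrix (Fin (4 * d + 8)) (Fin (4 * d + 8)) ℝ :=
  ∑ k : Fin d, Matrix.single (bi a k) (bi b k) 1

/-- The matrix adding `c` times scalar coordinate `t` to scalar coordinate `s`. -/
def ent {d : ℕ} (s t : Fin 8) (c : ℝ) : Matrix (Fin (4 * d + 8)) (Fin (4 * d + 8)) ℝ :=
  Matrix.single (si s) (si t) c

@[simp] lemma blk_mulVec_bi {d : ℕ} (a b a' : Fin 4) (h : Fin (4 * d + 8) → ℝ) (k : Fin d) :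
    (blk a b *ᵥ h) (bi a' k) = if a' = a then h (bi b k) else 0 := by
  simp only [blk, Matrix.sum_mulVec, Matrix.single_mulVec, Finset.sum_apply, Function.update_apply,
    bi_inj, one_mul, Pi.zero_apply]
  split_ifs with h1
  · simp [h1]
  · simp [h1]

@[simp] lemma blk_mulVec_si {d : ℕ} (a b : Fin 4) (h : Fin (4 * d + 8) → ℝ) (s : Fin 8) :
    (blk a b *ᵥ h) (si s) = 0 := by
  simp [blk, Matrix.sum_mulVec, Matrix.single_mulVec, Finset.sum_apply,
    (bi_ne_si _ _ _).symm]

@[simp] lemma ent_mulVec_bi {d : ℕ} (s t : Fin 8) (c : ℝ) (h : Fin (4 * d + 8) → ℝ) (a : Fin 4)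
    (k : Fin d) : (ent s t c *ᵥ h) (bi a k) = 0 := by
  simp [ent, Matrix.single_mulVec, bi_ne_si]

@[simp] lemma ent_mulVec_si {d : ℕ} (s t s' : Fin 8) (c : ℝ) (h : Fin (4 * d + 8) → ℝ) :
    (ent s t c *ᵥ h) (si s') = if s' = s then c * h (si t) else 0 := by
  simp [ent, Matrix.single_mulVec, Function.update_apply, si_inj]

/-- The bilinear score `⟨Q h, h'⟩`. -/
def score {d : ℕ} (Q : Matrix (Fin (4 * d + 8)) (Fin (4 * d + 8)) ℝ)
    (h h' : Fin (4 * d + 8) → ℝ) : ℝ :=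
  (Q *ᵥ h) ⬝ᵥ h'

@[simp] lemma score_add {d : ℕ} (P Q : Matrix (Fin (4 * d + 8)) (Fin (4 * d + 8)) ℝ)
    (h h' : Fin (4 * d + 8) → ℝ) : score (P + Q) h h' = score P h h' + score Q h h' := by
  simp [score, Matrix.add_mulVec]

@[simp] lemma score_ent {d : ℕ} (s t : Fin 8) (c : ℝ) (h h' : Fin (4 * d + 8) → ℝ) :
    score (ent s t c) h h' = c * h (si t) * h' (si s) := by
  simp [score, ent, Matrix.single_mulVec, dotProduct, Function.update_apply]

@[simp] lemma score_blk {d : ℕ} (a b : Fin 4) (h h' : Fin (4 * d + 8) → ℝ) :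
    score (blk a b) h h' = ∑ k, h (bi b k) * h' (bi a k) := by
  simp only [score, blk, Matrix.sum_mulVec, Matrix.single_mulVec, sum_dotProduct]
  simp [dotProduct, Function.update_apply]

/-! ### Attention heads and layers -/

/-- The transformer layer with key matrices `1`, query and value matrices from the list `hs`, and
the feed-forward net with matrices `1` and `A`. -/
def mkLayer {d : ℕ} (hs : List (Matrix (Fin (4 * d + 8)) (Fin (4 * d + 8)) ℝ ×
      Matrix (Fin (4 * d + 8)) (Fin (4 * d + 8)) ℝ))
    (A : Matrix (Fin (4 * d + 8)) (Fin (4 * d + 8)) ℝ) : TFLayer (4 * d + 8) where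
  M := hs.length
  Q m := (hs.get m).1
  K _ := 1
  V m := (hs.get m).2
  width := 4 * d + 8
  W1 := 1
  W2 := A

/-- The update of token `j` produced by the heads `hs` on the tokens `τ 0, …, τ (n - 1)`. -/
def attnAdd {d : ℕ} (hs : List (Matrix (Fin (4 * d + 8)) (Fin (4 * d + 8)) ℝ ×
      Matrix (Fin (4 * d + 8)) (Fin (4 * d + 8)) ℝ))
    (n : ℕ) (τ : ℕ → Fin (4 * d + 8) → ℝ) (j : ℕ) (i : Fin (4 * d + 8)) : ℝ :=
  (hs.map fun p => ∑ j' ∈ Finset.range n,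
    relu (score p.1 (τ j) (τ j')) * (p.2 *ᵥ τ j') i).sum

lemma layerMap_mkLayer {d : ℕ} (act : ℝ → ℝ)
    (hs : List (Matrix (Fin (4 * d + 8)) (Fin (4 * d + 8)) ℝ ×
      Matrix (Fin (4 * d + 8)) (Fin (4 * d + 8)) ℝ))
    (A : Matrix (Fin (4 * d + 8)) (Fin (4 * d + 8)) ℝ)
    (n : ℕ) (τ : ℕ → Fin (4 * d + 8) → ℝ) :
    layerMap act (mkLayer hs A) ((List.range n).map τ) =
      (List.range n).map fun j i => τ j i + attnAdd hs n τ j i +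
        (A *ᵥ fun k => act (τ j k + attnAdd hs n τ j k)) i := by
  have key : ∀ (j : ℕ) (i : Fin (4 * d + 8)),
      ∑ m : Fin (mkLayer hs A).M, (((List.range n).map τ).map fun h' =>
        relu (((mkLayer hs A).Q m *ᵥ τ j) ⬝ᵥ ((mkLayer hs A).K m *ᵥ h')) *
          ((mkLayer hs A).V m *ᵥ h') i).sum = attnAdd hs n τ j i := by
    intro j i
    rw [attnAdd, ← List.sum_ofFn]
    congr 1
    apply List.ext_get
    · simp [mkLayer]
    · intro m h1 h2
      simp only [mkLayer, List.getElem_ofFn, Matrix.one_mulVec, List.map_map,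
        List.get_eq_getElem, List.getElem_map]
      rfl
  simp only [layerMap, attnOut, List.map_map]
  refine List.map_congr_left fun j _ => ?_
  simp only [Function.comp_apply, ← List.map_map, key]
  simp only [mkLayer, Matrix.one_mulVec]
  rfl

lemma layerMap_mkLayer_nil {d : ℕ} (act : ℝ → ℝ) (n : ℕ) (τ : ℕ → Fin (4 * d + 8) → ℝ) :
    layerMap act (mkLayer [] 0) ((List.range n).map τ) = (List.range n).map τ := by
  simp [layerMap_mkLayer, attnAdd]

lemma attnAdd_append {d : ℕ} (hs hs' : List (Matrix (Fin (4 * d + 8)) (Fin (4 * d + 8)) ℝ ×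
      Matrix (Fin (4 * d + 8)) (Fin (4 * d + 8)) ℝ))
    (n : ℕ) (τ : ℕ → Fin (4 * d + 8) → ℝ) (j : ℕ) (i : Fin (4 * d + 8)) :
    attnAdd (hs ++ hs') n τ j i = attnAdd hs n τ j i + attnAdd hs' n τ j i := by
  simp [attnAdd]

/-- Three heads that together attend with weight `1` where the score `Q` vanishes, and with
weight `0` where it is at least `1` in absolute value. -/
def bump {d : ℕ} (Q V : Matrix (Fin (4 * d + 8)) (Fin (4 * d + 8)) ℝ) :
    List (Matrix (Fin (4 * d + 8)) (Fin (4 * d + 8)) ℝ ×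
      Matrix (Fin (4 * d + 8)) (Fin (4 * d + 8)) ℝ) :=
  [(Q + ent 4 4 1, V), (Q, (-2 : ℝ) • V), (Q + ent 4 4 (-1), V)]

lemma attnAdd_bump {d : ℕ} (Q V : Matrix (Fin (4 * d + 8)) (Fin (4 * d + 8)) ℝ)
    (n : ℕ) (τ : ℕ → Fin (4 * d + 8) → ℝ) (j : ℕ) (i : Fin (4 * d + 8))
    (P : ℕ → Prop) [DecidablePred P] (hj : τ j (si 4) = 1)
    (h1 : ∀ j' < n, τ j' (si 4) = 1)
    (hP : ∀ j' < n, P j' → score Q (τ j) (τ j') = 0)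
    (hnP : ∀ j' < n, ¬ P j' → 1 ≤ |score Q (τ j) (τ j')|) :
    attnAdd (bump Q V) n τ j i =
      ∑ j' ∈ Finset.range n, if P j' then (V *ᵥ τ j') i else 0 := by
  simp only [attnAdd, bump, List.map_cons, List.map_nil, List.sum_cons, List.sum_nil, add_zero,
    ← Finset.sum_add_distrib]
  refine Finset.sum_congr rfl fun j' hj' => ?_
  rw [Finset.mem_range] at hj'
  simp only [score_add, score_ent, hj, h1 j' hj', Matrix.smul_mulVec, Pi.smul_apply, smul_eq_mul,
    relu]
  split_ifs with hp
  · rw [hP j' hj' hp]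
    norm_num
  · have := hnP j' hj' hp
    generalize score Q (τ j) (τ j') = c at *
    rcases le_abs.1 this with h | h
    · rw [max_eq_left (by linarith), max_eq_left (by linarith), max_eq_left (by linarith)]
      ring
    · rw [max_eq_right (by linarith), max_eq_right (by linarith), max_eq_right (by linarith)]
      ring

/-- Four heads that together attend with weight `X` where the score `Q` vanishes, and with
weight `0` where it is at least `4 S` in absolute value, provided `|X| ≤ 2 S`. -/
def gate {d : ℕ} (Q X V : Matrix (Fin (4 * d + 8)) (Fin (4 * d + 8)) ℝ) :
    List (Matrix (Fin (4 * d + 8)) (Fin (4 * d + 8)) ℝ ×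
      Matrix (Fin (4 * d + 8)) (Fin (4 * d + 8)) ℝ) :=
  [(Q + X + ent 4 5 2, V), (Q + ent 4 5 2, (-1 : ℝ) • V), (Q + X + ent 4 5 (-2), (-1 : ℝ) • V),
    (Q + ent 4 5 (-2), V)]

lemma attnAdd_gate {d : ℕ} (Q X V : Matrix (Fin (4 * d + 8)) (Fin (4 * d + 8)) ℝ)
    (n : ℕ) (τ : ℕ → Fin (4 * d + 8) → ℝ) (j : ℕ) (i : Fin (4 * d + 8)) (S : ℝ)
    (P : ℕ → Prop) [DecidablePred P] (hj : τ j (si 5) = S)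
    (h1 : ∀ j' < n, τ j' (si 4) = 1)
    (hX : ∀ j' < n, |score X (τ j) (τ j')| ≤ 2 * S)
    (hP : ∀ j' < n, P j' → score Q (τ j) (τ j') = 0)
    (hnP : ∀ j' < n, ¬ P j' → 4 * S ≤ |score Q (τ j) (τ j')|) :
    attnAdd (gate Q X V) n τ j i =
      ∑ j' ∈ Finset.range n,
        if P j' then score X (τ j) (τ j') * (V *ᵥ τ j') i else 0 := by
  simp only [attnAdd, gate, List.map_cons, List.map_nil, List.sum_cons, List.sum_nil, add_zero,
    ← Finset.sum_add_distrib]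
  refine Finset.sum_congr rfl fun j' hj' => ?_
  rw [Finset.mem_range] at hj'
  simp only [score_add, score_ent, hj, h1 j' hj', Matrix.smul_mulVec, Pi.smul_apply, smul_eq_mul,
    relu]
  have hx := abs_le.1 (hX j' hj')
  split_ifs with hp
  · rw [hP j' hj' hp]
    generalize score X (τ j) (τ j') = x at *
    rw [max_eq_left (by linarith), max_eq_left (by linarith), max_eq_right (by linarith),
      max_eq_right (by linarith)]
    ring
  · have := hnP j' hj' hp
    generalize score X (τ j) (τ j') = x at *
    generalize score Q (τ j) (τ j') = c at *
    rcases le_abs.1 this with h | h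
    · rw [max_eq_left (by linarith), max_eq_left (by linarith), max_eq_left (by linarith),
        max_eq_left (by linarith)]
      ring
    · rw [max_eq_right (by linarith), max_eq_right (by linarith), max_eq_right (by linarith),
        max_eq_right (by linarith)]
      ring

/-! ### Integer scores -/

lemma one_le_abs_mul_int {S : ℝ} (hS : 2 ≤ S) {b : ℤ} (hb : b ≠ 0) : S ≤ |S * b| := by
  have h1 : (1 : ℝ) ≤ |(b : ℝ)| := by exact_mod_cast Int.one_le_abs hb
  rw [abs_mul, abs_of_nonneg (by linarith)]
  nlinarith

lemma one_le_abs_pair {S : ℝ} (hS : 2 ≤ S) {a b : ℤ} (hab : ¬ (a = 0 ∧ b = 0))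
    (hb : |(b : ℝ)| ≤ 2 * S) : 1 ≤ |S * (4 * S * a + b)| := by
  by_cases ha : a = 0
  · have := one_le_abs_mul_int hS (b := b) (by tauto)
    rw [ha]
    simp only [Int.cast_zero, mul_zero, zero_add]
    linarith
  · have h1 : (1 : ℝ) ≤ |(a : ℝ)| := by exact_mod_cast Int.one_le_abs ha
    rw [abs_mul, abs_of_nonneg (by linarith)]
    have h2 : 4 * S * |(a : ℝ)| - |(b : ℝ)| ≤ |4 * S * a + b| := by
      have := abs_sub_abs_le_abs_sub (4 * S * a) (-(b : ℝ))
      rwa [abs_neg, abs_mul, abs_of_nonneg (by linarith : 0 ≤ 4 * S), sub_neg_eq_add] at this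
    have h3 : 2 * S ≤ |4 * S * a + b| := by nlinarith
    nlinarith

/-! ### The four nontrivial layers -/

/-- Attention heads of the first layer: count the data tokens, detect generated tokens and mark
the tokens that precede a data token. -/
def heads₁ (d : ℕ) : List (Matrix (Fin (4 * d + 8)) (Fin (4 * d + 8)) ℝ ×
    Matrix (Fin (4 * d + 8)) (Fin (4 * d + 8)) ℝ) :=
  bump (ent 6 4 1) (ent 0 5 1) ++
    (bump (ent 7 5 4 + ent 5 7 (-4) + ent 5 5 (-4) + ent 6 4 1) (ent 2 5 1) ++
      [(ent 6 4 (-1), ent 1 4 1)])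

/-- Attention heads of the second layer: collect the row vector belonging to each token. -/
def heads₂ (d : ℕ) : List (Matrix (Fin (4 * d + 8)) (Fin (4 * d + 8)) ℝ ×
    Matrix (Fin (4 * d + 8)) (Fin (4 * d + 8)) ℝ) :=
  bump (ent 7 5 4 + ent 5 7 (-4) + ent 5 5 (-4) + ent 6 4 1 + ent 4 6 (-1) + ent 4 5 (-1))
      (blk 2 0) ++
    bump (ent 6 4 1 + ent 4 5 (-1) + ent 5 2 4 + ent 5 5 (-4) + ent 5 1 (-4)) (blk 2 0)

/-- Attention heads of the third layer: copy the activated input and its layer index. -/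
def heads₃ (d : ℕ) : List (Matrix (Fin (4 * d + 8)) (Fin (4 * d + 8)) ℝ ×
    Matrix (Fin (4 * d + 8)) (Fin (4 * d + 8)) ℝ) :=
  bump (ent 4 7 1 + ent 4 5 1 + ent 4 0 (-1) + ent 7 4 (-1)) (blk 3 1 + ent 3 6 1)

/-- The linear map that clears the scratch space and updates the positional encoding. -/
def resetMat (d : ℕ) : Matrix (Fin (4 * d + 8)) (Fin (4 * d + 8)) ℝ :=
  (-1 : ℝ) • (blk 0 0 + blk 1 1 + blk 2 2 + blk 3 3 + ent 0 0 1 + ent 1 1 1 + ent 2 2 1 + ent 3 3 1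
    + ent 6 6 1 + ent 6 3 (-1) + ent 6 5 1 + ent 7 5 (-1))

/-- Attention heads of the fourth layer: apply the virtual weight matrix and reset the rest. -/
def heads₄ (d : ℕ) : List (Matrix (Fin (4 * d + 8)) (Fin (4 * d + 8)) ℝ ×
    Matrix (Fin (4 * d + 8)) (Fin (4 * d + 8)) ℝ) :=
  gate (ent 6 4 4 + ent 4 5 (-4) + ent 4 3 8) (blk 2 3) (blk 0 0) ++
    bump (ent 7 4 1 + ent 4 7 (-1)) (resetMat d)

/-- The number of data tokens among the first `n` tokens. -/
def dataCount (ω : ℕ → ℤ) (n : ℕ) : ℝ := ∑ j ∈ Finset.range n, if ω j = 0 then (1 : ℝ) else 0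

/-- A quantity that vanishes iff no token with negative layer index is present. -/
def genWeight (ω : ℕ → ℤ) (S : ℝ) (n : ℕ) : ℝ := ∑ j ∈ Finset.range n, relu (-(S * ω j))

/-- The mark of a token that is followed by a data token. -/
def dataNext (ω : ℕ → ℤ) (n j : ℕ) : ℝ := if j + 1 < n ∧ ω (j + 1) = 0 then 1 else 0

/-- The row vector collected by token `j`. -/
def rowVec {d : ℕ} (U : ℕ → Fin d → ℝ) (ω : ℕ → ℤ) (S : ℝ) (n j : ℕ) (k : Fin d) : ℝ :=
  (if j + 1 < n ∧ ω (j + 1) = ω j + 1 then U (j + 1) k else 0) +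
    if dataNext ω n j = 1 ∧ genWeight ω S n = 0 then
      ∑ j' ∈ Finset.range n, if ω j' = 1 then U j' k else 0 else 0

lemma layer_one {d n : ℕ} {S : ℝ} (U : ℕ → Fin d → ℝ) (ω : ℕ → ℤ) (hS : 2 ≤ S)
    (hω : ∀ j < n, -S ≤ 2 * (ω j : ℝ) ∧ (ω j : ℝ) ≤ S) :
    layerMap euaf (mkLayer (heads₁ d) (blk 1 0)) ((List.range n).map fun j =>
        tok ![U j, 0, 0, 0] ![0, 0, 0, 0, 1, S, S * ω j, S * (j + 1 : ℕ)]) =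
      (List.range n).map fun j =>
        tok ![U j, fun k => euaf (U j k), 0, 0] ![S * dataCount ω n, genWeight ω S n,
          S * dataNext ω n j, 0, 1, S, S * ω j, S * (j + 1 : ℕ)] := by
  rw [layerMap_mkLayer]
  refine List.map_congr_left fun j hj => ?_
  rw [List.mem_range] at hj
  set τ : ℕ → Fin (4 * d + 8) → ℝ := fun j =>
    tok ![U j, 0, 0, 0] ![0, 0, 0, 0, 1, S, S * ω j, S * (j + 1 : ℕ)] with hτ
  have key : ∀ i, τ j i + attnAdd (heads₁ d) n τ j i = tok ![U j, 0, 0, 0] ![S * dataCount ω n,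
      genWeight ω S n, S * dataNext ω n j, 0, 1, S, S * ω j, S * (j + 1 : ℕ)] i := by
    intro i
    rw [heads₁, attnAdd_append, attnAdd_append,
      attnAdd_bump _ _ n τ j i (fun j' => ω j' = 0) (by simp [hτ]) (by simp [hτ])
        (by intro j' _ h; simp [hτ, h])
        (by
          intro j' _ h
          have := one_le_abs_mul_int hS h
          refine (by linarith : (1 : ℝ) ≤ S).trans (this.trans (le_of_eq (congrArg _ ?_)))
          simp [hτ]),
      attnAdd_bump _ _ n τ j i (fun j' => j' = j + 1 ∧ ω j' = 0) (by simp [hτ]) (by simp [hτ])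
        (by
          rintro j' _ ⟨rfl, h⟩
          simp [hτ, h]
          ring)
        (by
          intro j' hj' h
          have := one_le_abs_pair hS (a := (j' : ℤ) - (j + 1)) (b := ω j') (by omega)
            (abs_le.2 ⟨by linarith [hω j' hj'], by linarith [hω j' hj']⟩)
          refine this.trans (le_of_eq (congrArg _ ?_))
          simp [hτ]
          ring)]
    rcases coord_cases i with ⟨a, k, rfl⟩ | ⟨s, rfl⟩
    · simp [hτ, attnAdd]
    · rw [tok_si]
      fin_cases s <;> simp [hτ, attnAdd, ite_and, dataCount, genWeight, dataNext,
        Finset.mul_sum, -Finset.sum_boole]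
  have hact : (fun k => euaf (τ j k + attnAdd (heads₁ d) n τ j k)) = fun k =>
      euaf (tok ![U j, 0, 0, 0] ![S * dataCount ω n,
        genWeight ω S n, S * dataNext ω n j, 0, 1, S, S * ω j, S * (j + 1 : ℕ)] k) :=
    funext fun k => congrArg euaf (key k)
  funext i
  rw [hact, key i]
  rcases coord_cases i with ⟨a, k, rfl⟩ | ⟨s, rfl⟩
  · fin_cases a <;> simp
  · simp

lemma genWeight_nonneg (ω : ℕ → ℤ) (S : ℝ) (n : ℕ) : 0 ≤ genWeight ω S n :=
  Finset.sum_nonneg fun _ _ => le_max_right _ _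

lemma le_genWeight {ω : ℕ → ℤ} {S : ℝ} {n j : ℕ} (hS : 0 ≤ S) (hj : j < n) (hω : ω j < 0) :
    S ≤ genWeight ω S n := by
  refine le_trans ?_ (Finset.single_le_sum (f := fun j => relu (-(S * ω j)))
    (fun _ _ => le_max_right _ _) (Finset.mem_range.2 hj))
  have : (ω j : ℝ) ≤ -1 := by exact_mod_cast Int.le_sub_one_of_lt hω
  refine le_trans ?_ (le_max_left _ _)
  nlinarith

lemma genWeight_eq_zero {ω : ℕ → ℤ} {S : ℝ} {n : ℕ} (hS : 0 ≤ S) (hω : ∀ j < n, 0 ≤ ω j) :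
    genWeight ω S n = 0 := by
  refine Finset.sum_eq_zero fun j hj => max_eq_right ?_
  have : (0 : ℝ) ≤ ω j := by exact_mod_cast hω j (Finset.mem_range.1 hj)
  nlinarith

lemma genWeight_eq_zero_or {ω : ℕ → ℤ} {S : ℝ} {n : ℕ} (hS : 0 ≤ S) :
    genWeight ω S n = 0 ∨ S ≤ genWeight ω S n := by
  by_cases h : ∀ j < n, 0 ≤ ω j
  · exact Or.inl (genWeight_eq_zero hS h)
  · push Not at h
    obtain ⟨j, hj, hω⟩ := h
    exact Or.inr (le_genWeight hS hj hω)

lemma layer_two {d n : ℕ} {S : ℝ} (U Y : ℕ → Fin d → ℝ) (ω : ℕ → ℤ) (hS : 2 ≤ S)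
    (hω : ∀ j < n, -S ≤ 2 * (ω j : ℝ) ∧ (ω j : ℝ) ≤ S) (C : ℝ) :
    layerMap relu (mkLayer (heads₂ d) 0) ((List.range n).map fun j =>
        tok ![U j, Y j, 0, 0] ![C, genWeight ω S n,
          S * dataNext ω n j, 0, 1, S, S * ω j, S * (j + 1 : ℕ)]) =
      (List.range n).map fun j =>
        tok ![U j, Y j, rowVec U ω S n j, 0] ![C, genWeight ω S n,
          S * dataNext ω n j, 0, 1, S, S * ω j, S * (j + 1 : ℕ)] := by
  rw [layerMap_mkLayer]
  refine List.map_congr_left fun j hj => funext fun i => ?_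
  rw [List.mem_range] at hj
  set τ : ℕ → Fin (4 * d + 8) → ℝ := fun j =>
    tok ![U j, Y j, 0, 0] ![C, genWeight ω S n,
      S * dataNext ω n j, 0, 1, S, S * ω j, S * (j + 1 : ℕ)] with hτ
  rw [heads₂, attnAdd_append,
    attnAdd_bump _ _ n τ j i (fun j' => j' = j + 1 ∧ ω j' = ω j + 1) (by simp [hτ]) (by simp [hτ])
      (by
        rintro j' _ ⟨rfl, h⟩
        simp [hτ, h]
        ring)
      (by
        intro j' hj' h
        have h1 := hω j hj
        have h2 := hω j' hj'
        have := one_le_abs_pair hS (a := (j' : ℤ) - (j + 1)) (b := ω j' - (ω j + 1)) (by omega)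
          (by push_cast; exact abs_le.2 ⟨by linarith, by linarith⟩)
        refine this.trans (le_of_eq (congrArg _ ?_))
        simp [hτ]
        ring),
    attnAdd_bump _ _ n τ j i
      (fun j' => (dataNext ω n j = 1 ∧ genWeight ω S n = 0) ∧ ω j' = 1) (by simp [hτ]) (by simp [hτ])
      (by
        rintro j' _ ⟨⟨h1, h2⟩, h3⟩
        simp [hτ, h1, h2, h3])
      (by
        intro j' hj' h
        have h1 := hω j' hj'
        have hG := genWeight_nonneg ω S n
        have hsc : score (ent 6 4 1 + ent 4 5 (-1) + ent 5 2 4 + ent 5 5 (-4) + ent 5 1 (-4))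
            (τ j) (τ j') = S * ((ω j' - 1 : ℤ) : ℝ) + 4 * S * S * (dataNext ω n j - 1)
              - 4 * S * genWeight ω S n := by
          simp [hτ]
          ring
        rw [hsc]
        have hd : dataNext ω n j = 1 ∨ dataNext ω n j = 0 := by
          unfold dataNext
          split_ifs <;> simp
        have hneg : ∀ x : ℝ, S * S ≤ x →
            1 ≤ |S * ((ω j' - 1 : ℤ) : ℝ) - x| := by
          intro x hx
          rw [abs_sub_comm]
          refine le_trans ?_ (le_abs_self _)
          push_cast
          nlinarith
        rcases hd with hd | hd
        · rcases genWeight_eq_zero_or (ω := ω) (n := n) (by linarith : 0 ≤ S) with hg | hg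
          · have := one_le_abs_mul_int hS (b := ω j' - 1) (by
              intro h0
              exact h ⟨⟨hd, hg⟩, by omega⟩)
            rw [hd, hg, sub_self, mul_zero, mul_zero, add_zero, sub_zero]
            linarith
          · rw [hd, sub_self, mul_zero, add_zero]
            exact hneg _ (by nlinarith)
        · rw [hd, zero_sub, add_sub_assoc, mul_neg_one, neg_sub_left, ← sub_eq_add_neg]
          exact hneg _ (by nlinarith))]
  rcases coord_cases i with ⟨a, k, rfl⟩ | ⟨s, rfl⟩
  · fin_cases a <;> simp [hτ, rowVec, ite_and]
  · simp [hτ]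

lemma layer_three {d n : ℕ} {S : ℝ} (U Y R : ℕ → Fin d → ℝ) (ω : ℕ → ℤ) (hS : 2 ≤ S)
    (N : ℕ) (G : ℝ) (F : ℕ → ℝ) :
    layerMap relu (mkLayer (heads₃ d) 0) ((List.range n).map fun j =>
        tok ![U j, Y j, R j, 0] ![S * N, G, F j, 0, 1, S, S * ω j, S * (j + 1 : ℕ)]) =
      (List.range n).map fun j =>
        tok ![U j, Y j, R j, fun k => ∑ j' ∈ Finset.range n, if j' + N = j + 1 then Y j' k else 0]
          ![S * N, G, F j, ∑ j' ∈ Finset.range n, if j' + N = j + 1 then S * ω j' else 0,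
            1, S, S * ω j, S * (j + 1 : ℕ)] := by
  rw [layerMap_mkLayer]
  refine List.map_congr_left fun j hj => funext fun i => ?_
  rw [List.mem_range] at hj
  set τ : ℕ → Fin (4 * d + 8) → ℝ := fun j =>
    tok ![U j, Y j, R j, 0] ![S * N, G, F j, 0, 1, S, S * ω j, S * (j + 1 : ℕ)] with hτ
  rw [heads₃,
    attnAdd_bump _ _ n τ j i (fun j' => j' + N = j + 1) (by simp [hτ]) (by simp [hτ])
      (by
        intro j' _ h
        have h' : (j' : ℝ) + N = j + 1 := by exact_mod_cast h
        simp [hτ]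
        linear_combination (-S) * h')
      (by
        intro j' hj' h
        have := one_le_abs_mul_int hS (b := (j : ℤ) + 1 - N - j') (by omega)
        refine (by linarith : (1 : ℝ) ≤ S).trans (this.trans (le_of_eq (congrArg _ ?_)))
        simp [hτ]
        ring)]
  rcases coord_cases i with ⟨a, k, rfl⟩ | ⟨s, rfl⟩
  · fin_cases a <;> simp [hτ, Matrix.add_mulVec]
  · fin_cases s <;> simp [hτ, Matrix.add_mulVec]

lemma layer_four {d n : ℕ} {S : ℝ} (U Y R X : ℕ → Fin d → ℝ) (ω : ℕ → ℤ) (hS : 2 ≤ S)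
    (G C : ℝ) (F W : ℕ → ℝ) (ν : ℤ) (j : ℕ) (hj : j < n) (hW : W j = S * ν)
    (hX : ∀ j' < n, |∑ k, X j k * R j' k| ≤ 2 * S) (τ : ℕ → Fin (4 * d + 8) → ℝ)
    (hτ : τ = fun j => tok ![U j, Y j, R j, X j]
      ![C, G, F j, W j, 1, S, S * ω j, S * (j + 1 : ℕ)]) (i : Fin (4 * d + 8)) :
    τ j i + attnAdd (heads₄ d) n τ j i =
      tok ![fun k => ∑ j' ∈ Finset.range n,
          if ω j' = 1 - 2 * ν then (∑ l, X j l * R j' l) * U j' k else 0, 0, 0, 0]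
        ![0, 0, 0, 0, 1, S, S * (ν - 1 : ℤ), S * (j + 2 : ℕ)] i := by
  rw [heads₄, attnAdd_append,
    attnAdd_gate _ _ _ n τ j i S (fun j' => ω j' = 1 - 2 * ν) (by simp [hτ]) (by simp [hτ])
      (by simpa [hτ] using hX)
      (by
        intro j' _ h
        simp [hτ, h, hW]
        ring)
      (by
        intro j' hj' h
        have := one_le_abs_mul_int hS (b := ω j' - (1 - 2 * ν)) (by omega)
        have h4 : score (ent 6 4 4 + ent 4 5 (-4) + ent 4 3 8) (τ j) (τ j') =
            4 * (S * (ω j' - (1 - 2 * ν) : ℤ)) := by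
          simp [hτ, hW]
          ring
        rw [h4, abs_mul, abs_of_pos (by norm_num : (0 : ℝ) < 4)]
        linarith),
    attnAdd_bump _ _ n τ j i (fun j' => j' = j) (by simp [hτ]) (by simp [hτ])
      (by
        rintro j' _ rfl
        simp [hτ])
      (by
        intro j' hj' h
        have := one_le_abs_mul_int hS (b := (j' : ℤ) - j) (by omega)
        refine (by linarith : (1 : ℝ) ≤ S).trans (this.trans (le_of_eq (congrArg _ ?_)))
        simp [hτ]
        ring)]
  rw [Finset.sum_ite_eq', if_pos (Finset.mem_range.2 hj)]
  rcases coord_cases i with ⟨a, k, rfl⟩ | ⟨s, rfl⟩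
  · fin_cases a <;> simp [hτ, resetMat, Matrix.add_mulVec, Matrix.neg_mulVec]
  · fin_cases s <;> simp [hτ, resetMat, Matrix.add_mulVec, Matrix.neg_mulVec, hW] <;> ring

/-! ### One generation step -/

/-- The transformer: four nontrivial layers followed by four identity layers. -/
def emulator (d : ℕ) : List (TFLayer (4 * d + 8)) :=
  [mkLayer (heads₁ d) (blk 1 0), mkLayer (heads₂ d) 0, mkLayer (heads₃ d) 0,
    mkLayer (heads₄ d) 0, mkLayer [] 0, mkLayer [] 0, mkLayer [] 0, mkLayer [] 0]

lemma getLastD_map_range {α : Type*} (f : ℕ → α) (m : ℕ) (x : α) :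
    ((List.range (m + 1)).map f).getLastD x = f m := by
  simp [List.range_succ]

lemma emulator_last {d s N : ℕ} {S : ℝ} (U : ℕ → Fin d → ℝ) (ω : ℕ → ℤ) (hS : 2 ≤ S)
    (hN : 0 < N) (hω : ∀ j < s + N, -S ≤ 2 * (ω j : ℝ) ∧ (ω j : ℝ) ≤ S)
    (hC : dataCount ω (s + N) = N)
    (hX : ∀ j < s + N, |∑ k, euaf (U s k) * rowVec U ω S (s + N) j k| ≤ 2 * S)
    (x : Fin (4 * d + 8) → ℝ) :
    (tfForwardEUAF (emulator d) ((List.range (s + N)).map fun j =>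
        promptToken d (U j) (ω j) (j + 1) S)).getLastD x =
      promptToken d (fun k => ∑ j ∈ Finset.range (s + N), if ω j = 1 - 2 * ω s then
          (∑ l, euaf (U s l) * rowVec U ω S (s + N) j l) * U j k else 0)
        (ω s - 1) (s + N + 1) S := by
  obtain ⟨m, hm⟩ : ∃ m, s + N = m + 1 := ⟨s + N - 1, by omega⟩
  have hs : s < m + 1 := by omega
  have hsrc : ∀ j', j' + N = m + 1 ↔ j' = s := fun j' => by omega
  simp only [promptToken_eq_tok, tfForwardEUAF, emulator, List.foldl_cons, List.foldl_nil]
  rw [layer_one U ω hS hω, layer_two U _ ω hS hω, hC, layer_three _ _ _ _ hS, layerMap_mkLayer]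
  simp only [layerMap_mkLayer_nil]
  rw [hm] at hX ⊢
  rw [getLastD_map_range]
  funext i
  rw [Matrix.zero_mulVec, Pi.zero_apply, add_zero]
  refine (layer_four U (fun j k => euaf (U j k)) (fun j => rowVec U ω S (m + 1) j)
    (fun j k => ∑ j' ∈ Finset.range (m + 1), if j' + N = j + 1 then euaf (U j' k) else 0) ω hS
    (genWeight ω S (m + 1)) (S * N) (fun j => S * dataNext ω (m + 1) j)
    (fun j => ∑ j' ∈ Finset.range (m + 1), if j' + N = j + 1 then S * ω j' else 0)
    (ω s) m (Nat.lt_add_one m) ?_ ?_ _ rfl i).trans ?_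
  · simp only [hsrc, Finset.sum_ite_eq', Finset.mem_range, if_pos hs]
  · simpa only [hsrc, Finset.sum_ite_eq', Finset.mem_range, if_pos hs]
      using hX
  · simp only [hsrc, Finset.sum_ite_eq', Finset.mem_range, if_pos hs]

lemma abs_euaf_le_one (x : ℝ) : |euaf x| ≤ 1 := by
  unfold euaf
  split_ifs with h
  · have h1 := Int.floor_le ((x + 1) / 2)
    have h2 := Int.lt_floor_add_one ((x + 1) / 2)
    rw [abs_abs, abs_le]
    constructor <;> linarith
  · rw [abs_div, abs_of_pos (by positivity : (0 : ℝ) < 1 + |x|), div_le_one (by positivity)]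
    linarith

lemma euaf_of_mem_Icc {x : ℝ} (hx : x ∈ Set.Icc (0 : ℝ) 1) : euaf x = x := by
  obtain ⟨h0, h1⟩ := hx
  unfold euaf
  rw [if_pos h0]
  rcases h1.lt_or_eq with h | h
  · rw [show ⌊(x + 1) / 2⌋ = 0 by
      rw [Int.floor_eq_iff]
      constructor <;> push_cast <;> linarith]
    simpa using h0
  · rw [h]
    norm_num

lemma abs_le_of_mem_eball {d : ℕ} {B : ℝ} {v : Fin d → ℝ} (hv : v ∈ eball d B) (k : Fin d) :
    |v k| ≤ B := by
  refine le_trans ?_ hv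
  rw [← Real.sqrt_sq_eq_abs]
  exact Real.sqrt_le_sqrt
    (Finset.single_le_sum (f := fun k => v k ^ 2) (fun _ _ => sq_nonneg _) (Finset.mem_univ k))

/-! ### The generated sequence -/

lemma vecMulVec_mulVec_apply {d : ℕ} (a b y : Fin d → ℝ) (k : Fin d) :
    (vecMulVec a b *ᵥ y) k = (∑ l, y l * b l) * a k := by
  simp only [Matrix.mulVec, dotProduct, vecMulVec_apply, Finset.sum_mul]
  exact Finset.sum_congr rfl fun l _ => by ring

section Sequence

variable {d T N : ℕ} (hN : 0 < N) (u : Fin T → Fin d → ℝ) (w : Fin T → ℕ) (z : Fin N → Fin d → ℝ)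

/-- The word embeddings of the sequence: prompt, data, and outputs of the virtual network. -/
def seqEmb (m : ℕ) : Fin d → ℝ :=
  if h : m < T then u ⟨m, h⟩
  else vnetOut d euaf (WPfam u w ((m - T) % N)) (z ⟨(m - T) % N, Nat.mod_lt _ hN⟩) ((m - T) / N)

/-- The layer indices of the sequence. -/
def seqIdx (N : ℕ) (w : Fin T → ℕ) (m : ℕ) : ℤ :=
  if h : m < T then w ⟨m, h⟩ else -((m - T) / N : ℕ)

/-- The tokens of the sequence. -/
def seqTok (S : ℝ) (m : ℕ) : Fin (4 * d + 8) → ℝ :=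
  promptToken d (seqEmb hN u w z m) (seqIdx N w m) (m + 1) S

lemma seqEmb_add {ℓ : ℕ} (i : Fin N) :
    seqEmb hN u w z (T + N * ℓ + i) = vnetOut d euaf (WPfam u w i) (z i) ℓ := by
  have h1 : T + N * ℓ + i - T = N * ℓ + i := by omega
  have h2 : (N * ℓ + i) % N = i := by rw [Nat.mul_add_mod, Nat.mod_eq_of_lt i.2]
  have h3 : (N * ℓ + i) / N = ℓ := by
    rw [Nat.mul_add_div hN, Nat.div_eq_of_lt i.2, add_zero]
  rw [seqEmb, dif_neg (by omega)]
  simp only [h1, h2, h3]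

variable {w}

lemma seqIdx_of_lt {m : ℕ} (h : m < T) : seqIdx N w m = w ⟨m, h⟩ := dif_pos h

lemma seqIdx_of_le {m : ℕ} (h : T ≤ m) : seqIdx N w m = -((m - T) / N : ℕ) :=
  dif_neg (by omega)

lemma seqIdx_add (hN : 0 < N) {ℓ : ℕ} (i : Fin N) : seqIdx N w (T + N * ℓ + i) = -(ℓ : ℤ) := by
  rw [seqIdx_of_le (by omega), show T + N * ℓ + i - T = N * ℓ + i by omega, Nat.mul_add_div hN,
    Nat.div_eq_of_lt i.2, add_zero]

lemma seqIdx_nonpos {m : ℕ} (h : T ≤ m) : seqIdx N w m ≤ 0 := by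
  rw [seqIdx_of_le h]
  exact neg_nonpos.2 (Int.natCast_nonneg _)

lemma seqIdx_pos (hw : ∀ j, 1 ≤ w j) {m : ℕ} (h : m < T) : 1 ≤ seqIdx N w m := by
  rw [seqIdx_of_lt h]
  exact_mod_cast hw _

lemma seqIdx_eq_zero_iff (hN : 0 < N) (hw : ∀ j, 1 ≤ w j) {m : ℕ} :
    seqIdx N w m = 0 ↔ T ≤ m ∧ m < T + N := by
  rcases lt_or_ge m T with h | h
  · have := seqIdx_pos (N := N) hw h
    omega
  · rw [seqIdx_of_le h, neg_eq_zero, Nat.cast_eq_zero, Nat.div_eq_zero_iff]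
    omega

lemma seqIdx_succ_ne {m : ℕ} (h : T ≤ m) : seqIdx N w (m + 1) ≠ seqIdx N w m + 1 := by
  rw [seqIdx_of_le h, seqIdx_of_le (by omega)]
  have : (m - T) / N ≤ (m + 1 - T) / N := Nat.div_le_div_right (by omega)
  omega

lemma dataCount_seqIdx (hN : 0 < N) (hw : ∀ j, 1 ≤ w j) {s : ℕ} (hs : T ≤ s) :
    dataCount (seqIdx N w) (s + N) = N := by
  rw [dataCount, Finset.sum_boole]
  have : Finset.filter (fun j => seqIdx N w j = 0) (Finset.range (s + N)) =
      Finset.Ico T (T + N) := by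
    ext m
    rw [Finset.mem_filter, Finset.mem_range, Finset.mem_Ico, seqIdx_eq_zero_iff hN hw]
    omega
  rw [this, Nat.card_Ico, Nat.add_sub_cancel_left]

lemma genWeight_seqIdx (hN : 0 < N) (hw : ∀ j, 1 ≤ w j) {S : ℝ} (hS : 2 ≤ S) {s : ℕ}
    (hs : T ≤ s) : genWeight (seqIdx N w) S (s + N) = 0 ↔ s = T := by
  constructor
  · intro h
    by_contra hne
    have h1 : seqIdx N w (T + N) < 0 := by
      have := seqIdx_add (w := w) hN (ℓ := 1) ⟨0, hN⟩
      simp only [mul_one, add_zero] at this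
      rw [this]
      norm_num
    have := le_genWeight (n := s + N) (by linarith : 0 ≤ S) (by omega) h1
    linarith
  · rintro rfl
    refine genWeight_eq_zero (by linarith) fun j hj => ?_
    rcases lt_or_ge j s with h | h
    · linarith [seqIdx_pos (N := N) hw h]
    · rw [(seqIdx_eq_zero_iff hN hw).2 ⟨h, by omega⟩]

lemma dataNext_seqIdx (hN : 0 < N) (hw : ∀ j, 1 ≤ w j) {s j : ℕ} (hs : T ≤ s) (hj : j < T) :
    dataNext (seqIdx N w) (s + N) j = 1 ↔ j + 1 = T := by
  rw [dataNext, ite_eq_left_iff, seqIdx_eq_zero_iff hN hw]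
  constructor
  · intro h
    by_contra hne
    exact zero_ne_one (h (by omega))
  · intro h1 h2
    omega

lemma sum_prompt_row {s : ℕ} (hs : T ≤ s) (k : Fin d) :
    (∑ j ∈ Finset.range (s + N), if seqIdx N w j = 1 then seqEmb hN u w z j k else 0) =
      ∑ j : Fin T, if w j = 1 then u j k else 0 := by
  rw [show s + N = T + (s - T + N) by omega, Finset.sum_range_add, Finset.sum_range,
    Finset.sum_eq_zero (s := Finset.range (s - T + N)), add_zero]
  · refine Finset.sum_congr rfl fun j _ => ?_
    simp only [seqIdx_of_lt j.2, seqEmb, dif_pos j.2, Nat.cast_eq_one]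
  · intro j _
    have := seqIdx_nonpos (N := N) (w := w) (show T ≤ T + j by omega)
    exact if_neg (by omega)

lemma rowVec_seq (hw : ∀ j, 1 ≤ w j) {S : ℝ} (hS : 2 ≤ S) {s : ℕ} (hs : T ≤ s) (j : Fin T)
    (k : Fin d) :
    rowVec (seqEmb hN u w z) (seqIdx N w) S (s + N) j k =
      (if h : (j : ℕ) + 1 < T then if w ⟨j + 1, h⟩ = w j + 1 then u ⟨j + 1, h⟩ k else 0 else 0) +
        if (j : ℕ) + 1 = T ∧ s = T then ∑ j' : Fin T, if w j' = 1 then u j' k else 0 else 0 := by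
  rw [rowVec]
  congr 1
  · by_cases h : (j : ℕ) + 1 < T
    · rw [dif_pos h, seqIdx_of_lt h, seqIdx_of_lt j.2, seqEmb, dif_pos h, Fin.eta]
      refine if_congr ⟨fun h' => by omega, fun h' => ⟨by omega, by omega⟩⟩ rfl rfl
    · rw [dif_neg h, if_neg]
      have h1 := seqIdx_pos (N := N) hw j.2
      have h2 := seqIdx_nonpos (N := N) (w := w) (not_lt.1 h)
      omega
  · rw [sum_prompt_row hN u z hs]
    exact if_congr (and_congr (dataNext_seqIdx hN hw hs j.2) (genWeight_seqIdx hN hw hS hs)) rfl rfl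

lemma abs_rowVec_seq_le (hw : ∀ j, 1 ≤ w j) {S B : ℝ} (hB : 0 ≤ B) (hu : ∀ j k, |u j k| ≤ B)
    {s : ℕ} (hs : T ≤ s) (j : ℕ) (k : Fin d) :
    |rowVec (seqEmb hN u w z) (seqIdx N w) S (s + N) j k| ≤ B + T * B := by
  refine (abs_add_le _ _).trans (add_le_add ?_ ?_)
  · split_ifs with h
    · have hj : j + 1 < T := by
        by_contra hj
        have h1 := seqIdx_nonpos (N := N) (w := w) (not_lt.1 hj)
        rcases lt_or_ge j T with h2 | h2
        · have := seqIdx_pos (N := N) hw h2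
          omega
        · exact seqIdx_succ_ne h2 h.2
      rw [seqEmb, dif_pos hj]
      exact hu _ _
    · simpa using hB
  · split_ifs with h
    · rw [sum_prompt_row hN u z hs]
      refine (Finset.abs_sum_le_sum_abs _ _).trans ?_
      refine (Finset.sum_le_card_nsmul _ _ B fun j' _ => ?_).trans (by simp)
      split_ifs
      · exact hu _ _
      · simpa using hB
    · rw [abs_zero]
      positivity

/-- The attention sum over the prompt applies the virtual weight matrix. -/
lemma sum_rowVec_seq (hw : ∀ j, 1 ≤ w j) {S : ℝ} (hS : 2 ≤ S) (ℓ : ℕ) (i : Fin N)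
    (y : Fin d → ℝ) (k : Fin d) :
    (∑ j ∈ Finset.range (T + N * ℓ + i + N), if seqIdx N w j = 1 - 2 * (-(ℓ : ℤ)) then
      (∑ l, y l * rowVec (seqEmb hN u w z) (seqIdx N w) S (T + N * ℓ + i + N) j l) *
        seqEmb hN u w z j k else 0) = (WPfam u w i (ℓ + 1) *ᵥ y) k := by
  set s := T + N * ℓ + i with hs'
  have hs : T ≤ s := by omega
  have hsT : s = T ↔ ℓ = 0 ∧ (i : ℕ) = 0 := by
    constructor
    · intro h
      have : N * ℓ = 0 := by omega
      exact ⟨(Nat.mul_eq_zero.1 this).resolve_left hN.ne', by omega⟩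
    · rintro ⟨rfl, h⟩
      rw [hs', h]
      simp
  rw [show s + N = T + (s - T + N) by omega, Finset.sum_range_add, Finset.sum_range,
    Finset.sum_eq_zero (s := Finset.range (s - T + N)), add_zero,
    ← show s + N = T + (s - T + N) by omega]
  · have hfam : WPfam u w i (ℓ + 1) = WPmat u w (ℓ + 1) + if s = T then WPcorr u w else 0 := by
      rw [WPfam]
      split_ifs with h1 h2 h2
      · obtain rfl : ℓ = 0 := by omega
        simp [WPone, (hsT.1 h2).2]
      · have : (i : ℕ) ≠ 0 := fun h => h2 (hsT.2 ⟨by omega, h⟩)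
        obtain rfl : ℓ = 0 := by omega
        simp [WPone, this]
      · exact absurd (by rw [(hsT.1 h2).1]) h1
      · rw [add_zero]
    have hterm : ∀ j : Fin T, (if seqIdx N w j = 1 - 2 * (-(ℓ : ℤ)) then
        (∑ l, y l * rowVec (seqEmb hN u w z) (seqIdx N w) S (s + N) j l) *
          seqEmb hN u w z j k else 0) =
        ((if h : (j : ℕ) + 1 < T then
          (if w j = 2 * (ℓ + 1) - 1 ∧ w ⟨(j : ℕ) + 1, h⟩ = 2 * (ℓ + 1) then
            vecMulVec (u j) (u ⟨(j : ℕ) + 1, h⟩) else 0)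
          else (0 : Matrix (Fin d) (Fin d) ℝ)) *ᵥ y) k +
        if (j : ℕ) + 1 = T ∧ s = T ∧ w j = 1 then
          (∑ l, y l * ∑ j' : Fin T, if w j' = 1 then u j' l else 0) * u j k else 0 := by
      intro j
      simp only [rowVec_seq hN u z hw hS hs, mul_add, Finset.sum_add_distrib, add_mul]
      rw [seqIdx_of_lt j.2, seqEmb, dif_pos j.2, Fin.eta]
      by_cases hc : w j = 2 * ℓ + 1
      · rw [if_pos (by omega)]
        congr 1
        · by_cases h : (j : ℕ) + 1 < T
          · by_cases h2 : w ⟨j + 1, h⟩ = w j + 1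
            · rw [dif_pos h, if_pos ⟨by omega, by omega⟩, vecMulVec_mulVec_apply]
              simp only [dif_pos h, if_pos h2]
            · rw [dif_pos h, if_neg (by omega)]
              simp [h, h2]
          · simp [h]
        · by_cases h : (j : ℕ) + 1 = T ∧ s = T
          · have h1 : w j = 1 := by
              have := (hsT.1 h.2).1
              omega
            simp only [if_pos h, if_pos (⟨h.1, h.2, h1⟩ : (j : ℕ) + 1 = T ∧ s = T ∧ w j = 1)]
          · rw [if_neg fun h' => h ⟨h'.1, h'.2.1⟩]
            simp [h]
      · rw [if_neg (by omega), if_neg, add_zero]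
        · split_ifs with h h2
          · omega
          · simp
          · simp
        · rintro ⟨-, h, h1⟩
          have := (hsT.1 h).1
          omega
    rw [hfam, Matrix.add_mulVec, Pi.add_apply, WPmat, Matrix.sum_mulVec, Finset.sum_apply,
      Finset.sum_congr rfl fun j _ => hterm j, Finset.sum_add_distrib]
    congr 1
    by_cases hT : 0 < T
    · rw [Finset.sum_eq_single (⟨T - 1, by omega⟩ : Fin T), WPcorr, dif_pos hT]
      · simp only [show T - 1 + 1 = T by omega, true_and]
        by_cases h : s = T ∧ w ⟨T - 1, by omega⟩ = 1
        · rw [if_pos h, if_pos h.1, if_pos h.2, vecMulVec_mulVec_apply]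
          simp only [Finset.sum_apply, ite_apply, Pi.zero_apply]
        · rw [if_neg h]
          split_ifs with h1 h2
          · exact absurd ⟨h1, h2⟩ h
          · simp
          · simp
      · intro j _ hj
        refine if_neg fun h => hj (Fin.ext ?_)
        have := h.1
        simp only
        omega
      · simp
    · obtain rfl : T = 0 := by omega
      simp [WPcorr]
  · intro j _
    have := seqIdx_nonpos (N := N) (w := w) (show T ≤ T + j by omega)
    rw [if_neg (by omega)]

/-- One step of autoregressive generation. -/
lemma emulator_step (hw : ∀ j, 1 ≤ w j) {S : ℝ} (hS : 2 ≤ S) {L : ℕ} (hL : 2 * (L : ℝ) ≤ S)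
    (hw' : ∀ j, w j ≤ 2 * L) (hz : ∀ i k, z i k ∈ Set.Icc (0 : ℝ) 1)
    {B : ℝ} (hB : 0 ≤ B) (hu : ∀ j k, |u j k| ≤ B) (hdB : d * (B + T * B) ≤ 2 * S)
    {v : ℕ} (hv : v < N * L) (x : Fin (4 * d + 8) → ℝ) :
    (tfForwardEUAF (emulator d)
      ((List.range (T + N + v)).map (seqTok hN u w z S))).getLastD x =
      seqTok hN u w z S (T + N + v) := by
  set i : Fin N := ⟨v % N, Nat.mod_lt _ hN⟩ with hi
  obtain ⟨ℓ, hℓ⟩ : ∃ ℓ, v = N * ℓ + i := ⟨v / N, (Nat.div_add_mod v N).symm⟩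
  have hn : T + N + v = T + N * ℓ + i + N := by omega
  have hn' : T + N + v = T + N * (ℓ + 1) + i := by rw [hn]; ring
  have hidx : ∀ j < T + N * ℓ + i + N,
      -S ≤ 2 * (seqIdx N w j : ℝ) ∧ (seqIdx N w j : ℝ) ≤ S := by
    intro j hj
    have hL0 : (0 : ℝ) ≤ L := Nat.cast_nonneg L
    rcases lt_or_ge j T with h | h
    · rw [seqIdx_of_lt h]
      have h1 : ((w ⟨j, h⟩ : ℕ) : ℝ) ≤ 2 * L := by exact_mod_cast hw' _
      have h2 : (0 : ℝ) ≤ (w ⟨j, h⟩ : ℕ) := Nat.cast_nonneg _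
      push_cast
      constructor <;> linarith
    · rw [seqIdx_of_le h]
      have h0 : (j - T) / N ≤ L := by
        rw [← Nat.lt_add_one_iff, Nat.div_lt_iff_lt_mul hN, add_mul, one_mul, mul_comm L]
        omega
      have h1 : (((j - T) / N : ℕ) : ℝ) ≤ L := by exact_mod_cast h0
      have h2 : (0 : ℝ) ≤ ((j - T) / N : ℕ) := Nat.cast_nonneg _
      rw [Int.cast_neg, Int.cast_natCast]
      constructor <;> linarith
  have hX : ∀ y : Fin d → ℝ, (∀ l, |y l| ≤ 1) → ∀ j,
      |∑ l, y l * rowVec (seqEmb hN u w z) (seqIdx N w) S (T + N * ℓ + i + N) j l| ≤ 2 * S := by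
    intro y hy j
    refine ((Finset.abs_sum_le_sum_abs _ _).trans
      (Finset.sum_le_card_nsmul _ _ (B + T * B) fun l _ => ?_)).trans (by simpa [mul_add] using hdB)
    rw [abs_mul, ← one_mul (B + T * B)]
    exact mul_le_mul (hy l) (abs_rowVec_seq_le hN u z hw hB hu (by omega) j l) (abs_nonneg _)
      zero_le_one
  rw [hn]
  refine (emulator_last _ _ hS hN hidx (dataCount_seqIdx hN hw (by omega))
    (fun j _ => hX _ (fun l => abs_euaf_le_one _) j) x).trans ?_
  rw [seqTok, ← hn, hn', seqIdx_add hN, seqIdx_add hN, seqEmb_add, ← hn', hn]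
  congr 1
  · funext k
    rw [sum_rowVec_seq hN u z hw hS, ← hn, hn', seqEmb_add, vnetOut]
    congr 1
    rcases Nat.eq_zero_or_pos ℓ with rfl | h
    · simp only [if_true, vnetOut]
      exact funext fun l => euaf_of_mem_Icc (hz i l)
    · simp only [if_neg h.ne']
  · push_cast
    ring

lemma initialInput_eq (S : ℝ) :
    initialInput d T N u w S z = (List.range (T + N)).map (seqTok hN u w z S) := by
  rw [List.range_add, List.map_append, initialInput, List.map_map]
  congr 1
  · rw [← List.map_coe_finRange_eq_range, List.map_map]
    refine List.map_congr_left fun j _ => ?_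
    simp only [Function.comp_apply, seqTok, seqIdx_of_lt j.2, seqEmb, dif_pos j.2]
  · rw [← List.map_coe_finRange_eq_range, List.map_map]
    refine List.map_congr_left fun i _ => ?_
    have h1 := seqEmb_add hN u w z (ℓ := 0) i
    have h2 := seqIdx_add (w := w) hN (ℓ := 0) i
    rw [mul_zero, add_zero] at h1 h2
    simp only [Function.comp_apply, seqTok, h1, h2, vnetOut, Nat.cast_zero, neg_zero]

lemma genTokens_emulator (hw : ∀ j, 1 ≤ w j) {S : ℝ} (hS : 2 ≤ S) {L : ℕ}
    (hL : 2 * (L : ℝ) ≤ S) (hw' : ∀ j, w j ≤ 2 * L) (hz : ∀ i k, z i k ∈ Set.Icc (0 : ℝ) 1)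
    {B : ℝ} (hB : 0 ≤ B) (hu : ∀ j k, |u j k| ≤ B) (hdB : d * (B + T * B) ≤ 2 * S)
    {v : ℕ} (hv : v ≤ N * L) :
    genTokens (tfForwardEUAF (emulator d)) (initialInput d T N u w S z) v =
      (List.range (T + N + v)).map (seqTok hN u w z S) := by
  induction v with
  | zero => exact initialInput_eq hN u z S
  | succ v ih =>
    rw [genTokens, ih (by omega), emulator_step hN u z hw hS hL hw' hz hB hu hdB (by omega),
      ← add_assoc, List.range_succ, List.map_append, List.map_singleton]

end Sequence

lemma emulatesWith_emulator (d : ℕ) (hd : 0 < d) :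
    EmulatesWith d (tfForwardEUAF (emulator d)) euaf := by
  intro B hB T L hT hL U hU S hS u w hv N hN z hz i ℓ hℓ1 hℓ
  have hB0 : 0 ≤ B := by linarith
  have hL1 : (1 : ℝ) ≤ L := by exact_mod_cast hL
  have hT1 : (1 : ℝ) ≤ T := by exact_mod_cast hT
  have hSL : 2 * (L : ℝ) ≤ S := (le_max_right _ _).trans hS
  have hdB : d * (B + T * B) ≤ 2 * S := by
    have h1 : B ≤ B ^ (4 * L) := le_self_pow₀ hB (by omega)
    have h2 : (T : ℝ) ≤ T ^ (2 * L) := le_self_pow₀ hT1 (by omega)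
    have h3 : d * B * T ≤ S := by
      refine le_trans ?_ ((le_max_left _ _).trans hS)
      gcongr
    have h4 : (d : ℝ) * B ≤ d * B * T := le_mul_of_one_le_right (by positivity) hT1
    linarith
  have hmul : N * ℓ ≤ N * L := Nat.mul_le_mul_left N hℓ
  have hmul' : N * 1 ≤ N * ℓ := Nat.mul_le_mul_left N hℓ1
  have hi := i.2
  have hlen : (initialInput d T N u w S z).length = T + N := by
    simp [initialInput]
  have hgen := genTokens_emulator hN u z (fun j => (hv.2 j).1) (by linarith) hSL
    (fun j => (hv.2 j).2) hz hB0 (fun j k => abs_le_of_mem_eball (hU (hv.1 j)) k) hdB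
    (v := T + N * ℓ + i + 1 - (T + N)) (by omega)
  rw [tokenAt, hlen, hgen, show T + N + (T + N * ℓ + i + 1 - (T + N)) = T + N * ℓ + i + 1 by omega,
    Nat.add_sub_cancel, List.getD_eq_getElem _ _ (by simp), List.getElem_map, List.getElem_range,
    seqTok, seqEmb_add, seqIdx_add hN]

/-! ### Size of the parameters -/

/-- The matrix `A` has at most `m * d` nonzero entries, all bounded by `m` in absolute value. -/
def Sparse {d : ℕ} (m : ℕ) (A : Matrix (Fin (4 * d + 8)) (Fin (4 * d + 8)) ℝ) : Prop :=
  (∃ s : Finset (Fin (4 * d + 8) × Fin (4 * d + 8)), s.card ≤ m * d ∧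
    ∀ i j, A i j ≠ 0 → (i, j) ∈ s) ∧ ∀ i j, |A i j| ≤ m

section Sparse

variable {d m n : ℕ} {A A' : Matrix (Fin (4 * d + 8)) (Fin (4 * d + 8)) ℝ}

lemma Sparse.mono (h : Sparse m A) (hmn : m ≤ n) : Sparse n A := by
  obtain ⟨⟨s, hs, hA⟩, hb⟩ := h
  exact ⟨⟨s, hs.trans (Nat.mul_le_mul_right d hmn), hA⟩,
    fun i j => (hb i j).trans (by exact_mod_cast hmn)⟩

lemma Sparse.add (h : Sparse m A) (h' : Sparse n A') : Sparse (m + n) (A + A') := by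
  obtain ⟨⟨s, hs, hA⟩, hb⟩ := h
  obtain ⟨⟨s', hs', hA'⟩, hb'⟩ := h'
  refine ⟨⟨s ∪ s', ?_, fun i j hij => ?_⟩, fun i j => ?_⟩
  · rw [add_mul]
    exact (Finset.card_union_le _ _).trans (add_le_add hs hs')
  · rw [Finset.mem_union]
    by_contra! hne
    refine hij ?_
    rw [Matrix.add_apply, not_imp_comm.1 (hA i j) hne.1, not_imp_comm.1 (hA' i j) hne.2, add_zero]
  · push_cast
    exact (abs_add_le _ _).trans (add_le_add (hb i j) (hb' i j))

lemma Sparse.smul {c : ℝ} (hc : |c| ≤ 2) (h : Sparse m A) : Sparse (2 * m) (c • A) := by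
  obtain ⟨⟨s, hs, hA⟩, hb⟩ := h
  refine ⟨⟨s, hs.trans (Nat.mul_le_mul_right d (by omega)), fun i j hij => hA i j ?_⟩,
    fun i j => ?_⟩
  · exact right_ne_zero_of_mul hij
  · rw [Matrix.smul_apply, smul_eq_mul, abs_mul]
    push_cast
    exact mul_le_mul hc (hb i j) (abs_nonneg _) zero_le_two

lemma sparse_zero : Sparse m (0 : Matrix (Fin (4 * d + 8)) (Fin (4 * d + 8)) ℝ) :=
  ⟨⟨∅, by simp, by simp⟩, by simp⟩

lemma sparse_one (hd : 0 < d) :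
    Sparse 12 (1 : Matrix (Fin (4 * d + 8)) (Fin (4 * d + 8)) ℝ) := by
  refine ⟨⟨Finset.univ.image fun i => (i, i), Finset.card_image_le.trans ?_, fun i j hij => ?_⟩,
    fun i j => ?_⟩
  · rw [Finset.card_univ, Fintype.card_fin]
    omega
  · have : i = j := by
      by_contra hne
      exact hij (Matrix.one_apply_ne hne)
    simp [this]
  · rw [Matrix.one_apply]
    split_ifs <;> norm_num

lemma sparse_ent (hd : 0 < d) (s t : Fin 8) {c : ℝ} (hc : |c| ≤ 8) :
    Sparse 8 (ent s t c : Matrix (Fin (4 * d + 8)) (Fin (4 * d + 8)) ℝ) := by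
  refine ⟨⟨{(si s, si t)}, ?_, fun i j hij => ?_⟩, fun i j => ?_⟩
  · rw [Finset.card_singleton]
    omega
  · by_contra hne
    refine hij ?_
    rw [ent, Matrix.single_apply, if_neg]
    rintro ⟨rfl, rfl⟩
    exact hne (Finset.mem_singleton_self _)
  · rw [ent, Matrix.single_apply]
    split_ifs
    · exact_mod_cast hc
    · norm_num

lemma sparse_blk (a b : Fin 4) :
    Sparse 8 (blk a b : Matrix (Fin (4 * d + 8)) (Fin (4 * d + 8)) ℝ) := by
  refine ⟨⟨Finset.univ.image fun k => (bi a k, bi b k), Finset.card_image_le.trans ?_,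
    fun i j hij => ?_⟩, fun i j => ?_⟩
  · rw [Finset.card_univ, Fintype.card_fin]
    omega
  · rw [blk, Matrix.sum_apply] at hij
    obtain ⟨k, -, hk⟩ := Finset.exists_ne_zero_of_sum_ne_zero hij
    rw [Matrix.single_apply, Ne, ite_eq_right_iff, Classical.not_imp] at hk
    exact Finset.mem_image.2 ⟨k, Finset.mem_univ k, Prod.ext hk.1.1 hk.1.2⟩
  · rw [blk, Matrix.sum_apply]
    rcases coord_cases i with ⟨a', k, rfl⟩ | ⟨s, rfl⟩
    · rw [Finset.sum_eq_single k, Matrix.single_apply]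
      · split_ifs <;> norm_num
      · intro l _ hl
        rw [Matrix.single_apply, if_neg fun h => hl (bi_inj.1 h.1).2]
      · simp
    · rw [Finset.sum_eq_zero]
      · norm_num
      · intro l _
        rw [Matrix.single_apply, if_neg fun h => bi_ne_si _ _ _ h.1]

/-- All query and value matrices in the list are sparse. -/
def SparseHeads (m : ℕ) (hs : List (Matrix (Fin (4 * d + 8)) (Fin (4 * d + 8)) ℝ ×
    Matrix (Fin (4 * d + 8)) (Fin (4 * d + 8)) ℝ)) : Prop :=
  ∀ p ∈ hs, Sparse m p.1 ∧ Sparse m p.2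

lemma SparseHeads.append {hs hs' : List (Matrix (Fin (4 * d + 8)) (Fin (4 * d + 8)) ℝ ×
    Matrix (Fin (4 * d + 8)) (Fin (4 * d + 8)) ℝ)} (h : SparseHeads m hs)
    (h' : SparseHeads m hs') : SparseHeads m (hs ++ hs') :=
  fun p hp => (List.mem_append.1 hp).elim (h p) (h' p)

lemma SparseHeads.bump (hd : 0 < d) (h : Sparse m A) (h' : Sparse n A') (hm : m + 8 ≤ 1000)
    (hn : 2 * n ≤ 1000) : SparseHeads 1000 (bump A A') := by
  have h1 := fun c hc => (h.add (sparse_ent hd 4 4 (c := c) hc)).mono hm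
  simp only [SparseHeads, PromptTF.bump, List.forall_mem_cons, List.not_mem_nil, false_imp_iff,
    implies_true, and_true]
  exact ⟨⟨h1 _ (by norm_num), h'.mono (by omega)⟩,
    ⟨h.mono (by omega), (h'.smul (by norm_num)).mono hn⟩, h1 _ (by norm_num), h'.mono (by omega)⟩

lemma SparseHeads.gate {X : Matrix (Fin (4 * d + 8)) (Fin (4 * d + 8)) ℝ} {l : ℕ} (hd : 0 < d)
    (h : Sparse m A) (hX : Sparse l X) (h' : Sparse n A') (hm : m + l + 8 ≤ 1000)
    (hn : 2 * n ≤ 1000) : SparseHeads 1000 (gate A X A') := by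
  have h1 := fun c hc => ((h.add hX).add (sparse_ent hd 4 5 (c := c) hc)).mono hm
  have h2 : ∀ c : ℝ, |c| ≤ 8 → Sparse 1000 (A + ent 4 5 c) := fun c hc =>
    (h.add (sparse_ent hd 4 5 hc)).mono (by omega)
  have h3 : Sparse 1000 ((-1 : ℝ) • A') := (h'.smul (by norm_num)).mono hn
  simp only [SparseHeads, PromptTF.gate, List.forall_mem_cons, List.not_mem_nil, false_imp_iff,
    implies_true, and_true]
  exact ⟨⟨h1 _ (by norm_num), h'.mono (by omega)⟩, ⟨h2 _ (by norm_num), h3⟩,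
    ⟨h1 _ (by norm_num), h3⟩, h2 _ (by norm_num), h'.mono (by omega)⟩

lemma sparseHeads₁ (hd : 0 < d) : SparseHeads 1000 (heads₁ d) := by
  have e := fun s t c (hc : |c| ≤ 8) => sparse_ent hd s t hc
  refine (SparseHeads.bump hd (e _ _ _ ?_) (e _ _ _ ?_) ?_ ?_).append
    ((SparseHeads.bump hd ((((e _ _ _ ?_).add (e _ _ _ ?_)).add (e _ _ _ ?_)).add (e _ _ _ ?_))
      (e _ _ _ ?_) ?_ ?_).append ?_)
  on_goal -1 =>
    intro p hp
    rw [List.mem_singleton.1 hp]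
    exact ⟨(e _ _ _ (by norm_num)).mono (by norm_num), (e _ _ _ (by norm_num)).mono (by norm_num)⟩
  all_goals norm_num

lemma sparseHeads₂ (hd : 0 < d) : SparseHeads 1000 (heads₂ d) := by
  have e := fun s t c (hc : |c| ≤ 8) => sparse_ent hd s t hc
  refine (SparseHeads.bump hd ((((((e _ _ _ ?_).add (e _ _ _ ?_)).add (e _ _ _ ?_)).add
      (e _ _ _ ?_)).add (e _ _ _ ?_)).add (e _ _ _ ?_)) (sparse_blk 2 0) ?_ ?_).append
    (SparseHeads.bump hd (((((e _ _ _ ?_).add (e _ _ _ ?_)).add (e _ _ _ ?_)).add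
      (e _ _ _ ?_)).add (e _ _ _ ?_)) (sparse_blk 2 0) ?_ ?_)
  all_goals norm_num

lemma sparseHeads₃ (hd : 0 < d) : SparseHeads 1000 (heads₃ d) := by
  have e := fun s t c (hc : |c| ≤ 8) => sparse_ent hd s t hc
  refine SparseHeads.bump hd ((((e _ _ _ ?_).add (e _ _ _ ?_)).add (e _ _ _ ?_)).add (e _ _ _ ?_))
    ((sparse_blk 3 1).add (e _ _ _ ?_)) ?_ ?_
  all_goals norm_num

lemma sparse_resetMat (hd : 0 < d) : Sparse 200 (resetMat d) := by
  have e := fun s t c (hc : |c| ≤ 8) => sparse_ent hd s t hc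
  refine (Sparse.smul ?_ ((((((((((((sparse_blk 0 0).add (sparse_blk 1 1)).add
    (sparse_blk 2 2)).add (sparse_blk 3 3)).add (e _ _ _ ?_)).add (e _ _ _ ?_)).add
    (e _ _ _ ?_)).add (e _ _ _ ?_)).add (e _ _ _ ?_)).add (e _ _ _ ?_)).add (e _ _ _ ?_)).add
    (e _ _ _ ?_))).mono ?_
  all_goals norm_num

lemma sparseHeads₄ (hd : 0 < d) : SparseHeads 1000 (heads₄ d) := by
  have e := fun s t c (hc : |c| ≤ 8) => sparse_ent hd s t hc
  refine (SparseHeads.gate hd (((e _ _ _ ?_).add (e _ _ _ ?_)).add (e _ _ _ ?_)) (sparse_blk 2 3)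
    (sparse_blk 0 0) ?_ ?_).append
    (SparseHeads.bump hd ((e _ _ _ ?_).add (e _ _ _ ?_)) (sparse_resetMat hd) ?_ ?_)
  all_goals norm_num

lemma Sparse.card_le (h : Sparse m A)
    [DecidablePred fun p : Fin (4 * d + 8) × Fin (4 * d + 8) => A p.1 p.2 ≠ 0] :
    (Finset.univ.filter fun p : Fin (4 * d + 8) × Fin (4 * d + 8) => A p.1 p.2 ≠ 0).card ≤
      m * d := by
  obtain ⟨⟨s, hs, hA⟩, -⟩ := h
  exact (Finset.card_le_card fun p hp => hA _ _ (Finset.mem_filter.1 hp).2).trans hs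

lemma card_heads_le {M : ℕ} (F : Fin M → Matrix (Fin (4 * d + 8)) (Fin (4 * d + 8)) ℝ)
    (hM : M ≤ 8) (hF : ∀ a, Sparse m (F a))
    [DecidablePred fun p : Fin M × Fin (4 * d + 8) × Fin (4 * d + 8) => F p.1 p.2.1 p.2.2 ≠ 0] :
    (Finset.univ.filter fun p : Fin M × Fin (4 * d + 8) × Fin (4 * d + 8) =>
      F p.1 p.2.1 p.2.2 ≠ 0).card ≤ 8 * (m * d) := by
  classical
  rw [Finset.card_filter, Fintype.sum_prod_type]
  refine (Finset.sum_le_card_nsmul _ _ (m * d) fun a _ => ?_).trans ?_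
  · refine le_trans (le_of_eq ?_) (hF a).card_le
    rw [Finset.card_filter]
    exact Finset.sum_congr rfl fun p _ => if_congr Iff.rfl rfl rfl
  · rw [Finset.card_univ, Fintype.card_fin, smul_eq_mul]
    exact Nat.mul_le_mul_right _ hM

lemma mkLayer_bounds {hs : List (Matrix (Fin (4 * d + 8)) (Fin (4 * d + 8)) ℝ ×
    Matrix (Fin (4 * d + 8)) (Fin (4 * d + 8)) ℝ)} (hd : 0 < d) (hlen : hs.length ≤ 8)
    (h : SparseHeads 1000 hs) (hA : Sparse 1000 A) :
    (mkLayer hs A).M ≤ 8 ∧ (mkLayer hs A).width ≤ 1000 * d ∧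
      layerNonzero (mkLayer hs A) ≤ 26000 * d ∧ layerEntriesBounded (mkLayer hs A) 1000 := by
  have hQ : ∀ m, Sparse 1000 ((mkLayer hs A).Q m) := fun m => (h _ (hs.get_mem m)).1
  have hK : ∀ m, Sparse 1000 ((mkLayer hs A).K m) := fun _ => (sparse_one hd).mono (by norm_num)
  have hV : ∀ m, Sparse 1000 ((mkLayer hs A).V m) := fun m => (h _ (hs.get_mem m)).2
  have hW : Sparse 1000 (1 : Matrix (Fin (4 * d + 8)) (Fin (4 * d + 8)) ℝ) :=
    (sparse_one hd).mono (by norm_num)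
  refine ⟨hlen, ?_, ?_, fun m => ?_, fun m => ?_, fun m => ?_, ?_, ?_⟩
  · change 4 * d + 8 ≤ 1000 * d
    omega
  · have h1 := card_heads_le _ hlen hQ
    have h2 := card_heads_le _ hlen hK
    have h3 := card_heads_le _ hlen hV
    have h4 := hW.card_le
    have h5 := hA.card_le
    unfold layerNonzero
    refine (add_le_add (add_le_add (add_le_add (add_le_add h1 h2) h3) h4) h5).trans ?_
    omega
  · exact_mod_cast (hQ m).2
  · exact_mod_cast (hK m).2
  · exact_mod_cast (hV m).2
  · exact_mod_cast hW.2
  · exact_mod_cast hA.2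

lemma emulator_bounds (hd : 0 < d) : ∀ θ ∈ emulator d, θ.M ≤ 8 ∧ θ.width ≤ 1000 * d ∧
    layerNonzero θ ≤ 26000 * d ∧ layerEntriesBounded θ 1000 := by
  have h0 := mkLayer_bounds (hs := []) hd (by simp) (by simp [SparseHeads]) sparse_zero
  simp only [emulator, List.forall_mem_cons, List.not_mem_nil, false_imp_iff, implies_true,
    and_true]
  exact ⟨mkLayer_bounds hd (by simp [heads₁, bump]) (sparseHeads₁ hd)
      ((sparse_blk 1 0).mono (by norm_num)),
    mkLayer_bounds hd (by simp [heads₂, bump]) (sparseHeads₂ hd) sparse_zero,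
    mkLayer_bounds hd (by simp [heads₃, bump]) (sparseHeads₃ hd) sparse_zero,
    mkLayer_bounds hd (by simp [heads₄, bump, gate]) (sparseHeads₄ hd) sparse_zero,
    h0, h0, h0, h0⟩

lemma tfNonzero_emulator_le (hd : 0 < d) : tfNonzero (emulator d) ≤ 208000 * d := by
  refine (List.sum_le_card_nsmul _ (26000 * d) fun k hk => ?_).trans ?_
  · obtain ⟨θ, hθ, rfl⟩ := List.mem_map.1 hk
    exact (emulator_bounds hd θ hθ).2.2.1
  · simp only [emulator, List.length_map, List.length_cons, List.length_nil, smul_eq_mul]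
    omega

end Sparse

end PromptTF

end


open PromptTF Matrix

/-- There is a universal constant `c > 0` such that for every `d ∈ ℕ+` there
are `8`-layer EUAF-transformer parameters `Θ#` with token dimension `4d+8`, at most `8`
attention heads per layer, FFN width at most `c·d`, at most `c·d` nonzero parameter entries in
total, all entries bounded by `c` in absolute value, which have the EUAF emulation property. -/
theorem statement_6 :
    ∃ c : ℕ, 0 < c ∧
      ∀ d : ℕ, 0 < d →
        ∃ Θ : List (TFLayer (4 * d + 8)),
          Θ.length = 8 ∧
          (∀ θ ∈ Θ, θ.M ≤ 8) ∧
          (∀ θ ∈ Θ, θ.width ≤ c * d) ∧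
          tfNonzero Θ ≤ c * d ∧
          (∀ θ ∈ Θ, layerEntriesBounded θ (c : ℝ)) ∧
          EmulatesWith d (tfForwardEUAF Θ) euaf := by
  refine ⟨208000, by norm_num, fun d hd => ⟨emulator d, rfl,
    fun θ hθ => (emulator_bounds hd θ hθ).1,
    fun θ hθ => (emulator_bounds hd θ hθ).2.1.trans (Nat.mul_le_mul_right d (by norm_num)),
    tfNonzero_emulator_le hd, fun θ hθ => ?_, emulatesWith_emulator d hd⟩⟩
  obtain ⟨hQ, hK, hV, hW₁, hW₂⟩ := (emulator_bounds hd θ hθ).2.2.2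
  have hc : (1000 : ℝ) ≤ (208000 : ℕ) := by norm_num
  exact ⟨fun m i j => (hQ m i j).trans hc, fun m i j => (hK m i j).trans hc,
    fun m i j => (hV m i j).trans hc, fun i j => (hW₁ i j).trans hc,
    fun i j => (hW₂ i j).trans hc⟩
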